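/- arXiv:math/0403076 — 3 statements merged into one kernel-verified Lean document; each statement's English description precedes it below -/
import Mathlib

section
/- Let π be a ∗-representation of X on a complex Hilbert space H and let η, φ ∈ K₀ := ker(π(y₀) − α^{-1}·I). Then for all multi-indices 𝔨, 𝔫 ∈ ℕ^d with |𝔨| + |𝔫| > 0: ⟨π((x^𝔨)*)η, π((x^𝔫)*)φ⟩ = δ_{𝔨,𝔫} · (n₁!⋯n_d!) / ((1+α)(2+α)⋯(|𝔫|+α))² · ⟨η, φ⟩, where δ_{𝔨,𝔫} is 1 if 𝔨 = 𝔫 and 0 otherwise. -/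
noncomputable section

/-- The Hilbert space `ℓ²(ℕ^d)`. -/
abbrev L2 (d : ℕ) := lp (fun _ : Fin d → ℕ => ℂ) 2

/-- Bounded operators on `ℓ²(ℕ^d)`. -/
abbrev BdOp (d : ℕ) := L2 d →L[ℂ] L2 d

/-- The standard basis vector `e_𝔫` of `ℓ²(ℕ^d)`. -/
def e2 (d : ℕ) (n : Fin d → ℕ) : L2 d := lp.single 2 n (1 : ℂ)

/-- The total degree `|𝔫| = n₁ + ⋯ + n_d`. -/
def degIdx (d : ℕ) (n : Fin d → ℕ) : ℕ := ∑ k, n k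

/-- The multi-index resulting from applying `a_k` (`k > 0`: annihilation at
slot `k`, `k < 0`: creation at slot `−k`, `k = 0` or `|k| > d`: identity)
to the basis vector `e_𝔫`. -/
def aIdx (d : ℕ) (k : ℤ) (n : Fin d → ℕ) : Fin d → ℕ :=
  if h : 0 < k ∧ k ≤ (d : ℤ) then
    Function.update n ⟨(k - 1).toNat, by omega⟩ (n ⟨(k - 1).toNat, by omega⟩ - 1)
  else if h' : 0 < -k ∧ -k ≤ (d : ℤ) then
    Function.update n ⟨(-k - 1).toNat, by omega⟩ (n ⟨(-k - 1).toNat, by omega⟩ + 1)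
  else n

/-- The coefficient of `a_k e_𝔫`: `√(n_k)` for `k > 0`, `√(n_{−k}+1)` for
`k < 0`, and `1` for `k = 0`, so that `a_k e_𝔫 = (aCoef k 𝔫) • e_{aIdx k 𝔫}`. -/
def aCoef (d : ℕ) (k : ℤ) (n : Fin d → ℕ) : ℝ :=
  if h : 0 < k ∧ k ≤ (d : ℤ) then Real.sqrt (n ⟨(k - 1).toNat, by omega⟩)
  else if h' : 0 < -k ∧ -k ≤ (d : ℤ) then Real.sqrt (n ⟨(-k - 1).toNat, by omega⟩ + 1)
  else 1

/-- The multi-index of `x_{kl} e_𝔫`. -/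
def xIdx (d : ℕ) (k l : ℤ) (n : Fin d → ℕ) : Fin d → ℕ := aIdx d k (aIdx d l n)

/-- The coefficient of `x_{kl} e_𝔫`, where `x_{kl} = a_k a_l (N+α)⁻¹` if
`k ≥ 0` or `l ≥ 0`, and `x_{kl} = (N+α)⁻¹ a_k a_l` if `k < 0` and `l < 0`. -/
def xCoef (d : ℕ) (α : ℝ) (k l : ℤ) (n : Fin d → ℕ) : ℝ :=
  if 0 ≤ k ∨ 0 ≤ l then aCoef d k (aIdx d l n) * aCoef d l n / (degIdx d n + α)
  else aCoef d k (aIdx d l n) * aCoef d l n / (degIdx d (xIdx d k l n) + α)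

/-- The eigenvalue of `y_m = (N + α + m)⁻¹` on `e_𝔫`. -/
def yCoef (d : ℕ) (α : ℝ) (m : ℤ) (n : Fin d → ℕ) : ℝ :=
  ((degIdx d n : ℝ) + α + m)⁻¹

/-- `xop`, `yop` implement the operators `x_{kl}` and `y_n` of Section 3:
each `x_{kl}` (for `|k|, |l| ≤ d`) acts on basis vectors as the continuous
extension of `a_k a_l (N+α)⁻¹` resp. `(N+α)⁻¹ a_k a_l`, and each `y_m` acts
diagonally with eigenvalue `(|𝔫|+α+m)⁻¹`. -/
def IsXYSystem (d : ℕ) (α : ℝ) (xop : ℤ → ℤ → BdOp d) (yop : ℤ → BdOp d) : Prop :=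
  (∀ k l : ℤ, |k| ≤ (d : ℤ) → |l| ≤ (d : ℤ) → ∀ n : Fin d → ℕ,
    xop k l (e2 d n) = (xCoef d α k l n : ℂ) • e2 d (xIdx d k l n)) ∧
  (∀ m : ℤ, ∀ n : Fin d → ℕ, yop m (e2 d n) = (yCoef d α m n : ℂ) • e2 d n)

/-- The auxiliary ∗-algebra `X`: the unital subalgebra of `B(ℓ²(ℕ^d))`
generated by the `x_{kl}` (`k, l = −d, …, d`) and the `y_n` (`n ∈ ℕ₀`). -/
def Xalg (d : ℕ) (xop : ℤ → ℤ → BdOp d) (yop : ℤ → BdOp d) :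
    Subalgebra ℂ (BdOp d) :=
  Algebra.adjoin ℂ
    ({T | ∃ k l : ℤ, |k| ≤ (d : ℤ) ∧ |l| ≤ (d : ℤ) ∧ T = xop k l} ∪
      {T | ∃ m : ℕ, T = yop m})

/-- `Σ²(X)`: finite sums `Σ_i g_i* g_i` with `g_i ∈ X`. -/
def XSumSq (d : ℕ) (X : Subalgebra ℂ (BdOp d)) : Set (BdOp d) :=
  {T | ∃ (m : ℕ) (g : Fin m → BdOp d),
    (∀ i, g i ∈ X) ∧ T = ∑ i, star (g i) * g i}

/-- The operator `x^𝔫 = x₁^{n₁} ⋯ x_d^{n_d}`, where `x_k = x_{k0}`. -/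
def xPowZ (d : ℕ) (xop : ℤ → ℤ → BdOp d) (n : Fin d → ℕ) : BdOp d :=
  (List.ofFn fun k : Fin d => xop ((k : ℕ) + 1 : ℤ) 0 ^ n k).prod

/-- A ∗-representation of `X` on `H`: a unital ℂ-algebra homomorphism into the
bounded operators on `H` respecting adjoints (`π(T*) = π(T)*`). -/
def IsStarRep (d : ℕ) (xop : ℤ → ℤ → BdOp d) (yop : ℤ → BdOp d)
    {H : Type*} [NormedAddCommGroup H] [InnerProductSpace ℂ H] [CompleteSpace H]
    (π : ↥(Xalg d xop yop) →ₐ[ℂ] (H →L[ℂ] H)) : Prop :=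
  ∀ T U : ↥(Xalg d xop yop), (T : BdOp d) = star (U : BdOp d) → π T = star (π U)

open scoped InnerProductSpace

/-- Polynomial relations between the annihilation-type operators `D k = x_k`, their adjoints
`S k` and the resolvents `y₀`, `y₁`. -/
structure IsNumberSystem {A : Type*} [Ring A] [Algebra ℂ A] (d : ℕ) (α : ℝ)
    (D S : Fin d → A) (y₀ y₁ : A) : Prop where
  sum_mul : ∑ k, S k * D k = y₀ - (α : ℂ) • (y₀ * y₀)
  shift : ∀ k, y₀ * S k = S k * y₁
  resolvent : y₀ = y₁ + y₁ * y₀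
  ccr : ∀ l k, D l * S k * (y₀ * y₀) =
    (if k = l then y₁ * y₁ * (y₀ * y₀) else 0) + S k * D l * (y₁ * y₁)

theorem IsNumberSystem.map {A B : Type*} [Ring A] [Algebra ℂ A] [Ring B] [Algebra ℂ B]
    {d : ℕ} {α : ℝ} {D S : Fin d → A} {y₀ y₁ : A} (h : IsNumberSystem d α D S y₀ y₁)
    (f : A →ₐ[ℂ] B) :
    IsNumberSystem d α (fun k => f (D k)) (fun k => f (S k)) (f y₀) (f y₁) where
  sum_mul := by simpa [-Complex.coe_smul] using congrArg f h.sum_mul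
  shift k := by simpa using congrArg f (h.shift k)
  resolvent := by simpa using congrArg f h.resolvent
  ccr l k := by simpa [apply_ite f] using congrArg f (h.ccr l k)

theorem IsNumberSystem.of_map {A B : Type*} [Ring A] [Algebra ℂ A] [Ring B] [Algebra ℂ B]
    {d : ℕ} {α : ℝ} {D S : Fin d → A} {y₀ y₁ : A} (f : A →ₐ[ℂ] B) (hf : Function.Injective f)
    (h : IsNumberSystem d α (fun k => f (D k)) (fun k => f (S k)) (f y₀) (f y₁)) :
    IsNumberSystem d α D S y₀ y₁ where
  sum_mul := hf (by simpa [-Complex.coe_smul] using h.sum_mul)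
  shift k := hf (by simpa using h.shift k)
  resolvent := hf (by simpa using h.resolvent)
  ccr l k := hf (by simpa [apply_ite f] using h.ccr l k)

theorem degIdx_add_single {d : ℕ} (n : Fin d → ℕ) (k : Fin d) :
    degIdx d (n + Pi.single k 1) = degIdx d n + 1 := by
  simp [degIdx, Finset.sum_add_distrib]

theorem single_one_le {d : ℕ} {n : Fin d → ℕ} {k : Fin d} (hk : n k ≠ 0) :
    Pi.single k 1 ≤ n := by
  intro i
  rcases eq_or_ne i k with rfl | hi
  · simpa using Nat.one_le_iff_ne_zero.2 hk
  · simp [hi]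

theorem exists_eq_add_single {d : ℕ} {n : Fin d → ℕ} {k : Fin d} (hk : n k ≠ 0) :
    ∃ m : Fin d → ℕ, n = m + Pi.single k 1 :=
  ⟨n - Pi.single k 1, (tsub_add_cancel_of_le (single_one_le hk)).symm⟩

/-- Induction on multi-indices by raising one entry at a time. -/
theorem multiIndex_induction {d : ℕ} {P : (Fin d → ℕ) → Prop} (zero : P 0)
    (add_single : ∀ n k, P n → P (n + Pi.single k 1)) (n : Fin d → ℕ) : P n := by
  induction h : degIdx d n generalizing n with
  | zero =>
    have : n = 0 := by
      funext i
      exact (Finset.sum_eq_zero_iff.1 h) i (Finset.mem_univ i)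
    exact this ▸ zero
  | succ M ih =>
    obtain ⟨k, -, hk⟩ : ∃ k ∈ Finset.univ, n k ≠ 0 :=
      Finset.exists_ne_zero_of_sum_ne_zero (by change degIdx d n ≠ 0; omega)
    obtain ⟨m, rfl⟩ := exists_eq_add_single hk
    refine add_single _ _ (ih _ ?_)
    simpa [degIdx_add_single] using h

section Vacuum

variable {H : Type*} [NormedAddCommGroup H] [InnerProductSpace ℂ H]
  {d : ℕ} {α : ℝ} {D S : Fin d → H →L[ℂ] H} {Y₀ Y₁ : H →L[ℂ] H}

theorem IsNumberSystem.annihilate_vacuum (h : IsNumberSystem d α D S Y₀ Y₁) (hα : 0 < α)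
    (hadj : ∀ k u w, ⟪S k u, w⟫_ℂ = ⟪u, D k w⟫_ℂ) {φ : H}
    (hφ : Y₀ φ = ((α : ℂ)⁻¹) • φ) (l : Fin d) : D l φ = 0 := by
  have h0 : ∑ k, S k (D k φ) = 0 := by
    have := congrArg (fun T : H →L[ℂ] H => T φ) h.sum_mul
    have hα' : (α : ℂ) ≠ 0 := by exact_mod_cast hα.ne'
    simpa [-Complex.coe_smul, hφ, smul_smul, hα'] using this
  have h1 : ∑ k, ‖D k φ‖ ^ 2 = 0 := by
    have := congrArg (fun u => RCLike.re ⟪u, φ⟫_ℂ) h0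
    simpa [sum_inner, hadj, ← Complex.ofReal_pow, inner_self_eq_norm_sq_to_K] using this
  have h2 := (Finset.sum_eq_zero_iff_of_nonneg (fun k _ => by positivity)).1 h1 l
    (Finset.mem_univ l)
  simpa using h2

theorem IsNumberSystem.resolvent_eigen (h : IsNumberSystem d α D S Y₀ Y₁) {c : ℂ} (hc : c ≠ 0)
    (hc1 : c + 1 ≠ 0) {v : H} (hv : Y₀ v = c⁻¹ • v) : Y₁ v = (c + 1)⁻¹ • v := by
  have h1 := congrArg (fun T : H →L[ℂ] H => T v) h.resolvent
  simp only [add_apply, mul_apply_eq_comp, hv, map_smul] at h1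
  have h2 : (1 + c⁻¹) • Y₁ v = c⁻¹ • v := by rw [h1, add_smul, one_smul]
  have h3 : (1 + c⁻¹) = c⁻¹ * (c + 1) := by field_simp
  rw [h3, mul_smul] at h2
  have h4 := smul_right_injective H (inv_ne_zero hc) h2
  exact (eq_inv_smul_iff₀ hc1).2 h4

variable {v : (Fin d → ℕ) → H}

theorem IsNumberSystem.number_eigen (h : IsNumberSystem d α D S Y₀ Y₁) (hα : 0 < α)
    (hv0 : Y₀ (v 0) = ((α : ℂ)⁻¹) • v 0)
    (hv : ∀ n k, v (n + Pi.single k 1) = S k (v n)) (n : Fin d → ℕ) :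
    Y₀ (v n) = ((α + degIdx d n : ℂ)⁻¹) • v n := by
  induction n using multiIndex_induction with
  | zero => simpa [degIdx] using hv0
  | add_single n k ih =>
    have hc : (α + degIdx d n : ℂ) ≠ 0 := by
      exact_mod_cast (by positivity : α + degIdx d n ≠ 0)
    have hc1 : (α + degIdx d n + 1 : ℂ) ≠ 0 := by
      exact_mod_cast (by positivity : α + degIdx d n + 1 ≠ 0)
    have h1 := congrArg (fun T : H →L[ℂ] H => T (v n)) (h.shift k)
    simp only [mul_apply_eq_comp, h.resolvent_eigen hc hc1 ih, map_smul] at h1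
    rw [hv, h1, degIdx_add_single]
    push_cast
    rw [add_assoc]

theorem IsNumberSystem.annihilate_create (h : IsNumberSystem d α D S Y₀ Y₁) {c : ℂ} (hc : c ≠ 0)
    (hc1 : c + 1 ≠ 0) {u : H} (hu : Y₀ u = c⁻¹ • u) (l k : Fin d) :
    D l (S k u) = ((c + 1) ^ 2)⁻¹ • ((if k = l then u else 0) + c ^ 2 • S k (D l u)) := by
  have h1 := congrArg (fun T : H →L[ℂ] H => T u) (h.ccr l k)
  have h2 := h.resolvent_eigen hc hc1 hu
  have h3 := congrArg (fun w => c ^ 2 • w) h1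
  have h4 : c ^ 2 * (c⁻¹ * c⁻¹) = 1 := by field_simp
  have h5 : c ^ 2 * ((c + 1)⁻¹ * (c + 1)⁻¹) = ((c + 1) ^ 2)⁻¹ * c ^ 2 := by field_simp
  split_ifs at h3 ⊢ with hkl
  · have h6 : c ^ 2 * (c⁻¹ * (c⁻¹ * ((c + 1)⁻¹ * (c + 1)⁻¹))) = ((c + 1) ^ 2)⁻¹ := by field_simp
    simpa [hu, h2, smul_smul, h4, h5, h6, mul_assoc] using h3
  · simpa [hu, h2, smul_smul, h4, h5, mul_assoc] using h3

theorem IsNumberSystem.annihilate_apply (h : IsNumberSystem d α D S Y₀ Y₁) (hα : 0 < α)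
    (hadj : ∀ k u w, ⟪S k u, w⟫_ℂ = ⟪u, D k w⟫_ℂ)
    (hv0 : Y₀ (v 0) = ((α : ℂ)⁻¹) • v 0)
    (hv : ∀ n k, v (n + Pi.single k 1) = S k (v n)) (l : Fin d) (n : Fin d → ℕ) :
    D l (v n) = (n l / (α + degIdx d n : ℂ) ^ 2) • v (n - Pi.single l 1) := by
  induction n using multiIndex_induction with
  | zero => simpa using h.annihilate_vacuum hα hadj hv0 l
  | add_single n k ih =>
    have hc : (α + degIdx d n : ℂ) ≠ 0 := by
      exact_mod_cast (by positivity : α + degIdx d n ≠ 0)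
    have hc1 : (α + degIdx d n + 1 : ℂ) ≠ 0 := by
      exact_mod_cast (by positivity : α + degIdx d n + 1 ≠ 0)
    have h1 : S k (D l (v n)) = (n l / (α + degIdx d n : ℂ) ^ 2) •
        v (n + Pi.single k 1 - Pi.single l 1) := by
      rw [ih, map_smul, ← hv]
      rcases eq_or_ne (n l) 0 with h0 | h0
      · simp [h0]
      · congr 2
        exact tsub_add_eq_add_tsub (single_one_le h0)
    rw [hv, h.annihilate_create hc hc1 (h.number_eigen hα hv0 hv n), h1, smul_smul,
      degIdx_add_single]
    rcases eq_or_ne k l with rfl | hkl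
    · simp only [if_true, add_tsub_cancel_right, Pi.add_apply, Pi.single_eq_same]
      nth_rewrite 1 [← one_smul ℂ (v n)]
      rw [← add_smul, smul_smul]
      congr 1
      push_cast
      rw [← add_assoc]
      field_simp
      ring
    · simp only [hkl, if_false, zero_add, smul_smul, Pi.add_apply, Pi.single_eq_of_ne hkl.symm,
        add_zero]
      congr 1
      push_cast
      rw [← add_assoc]
      field_simp

theorem IsNumberSystem.inner_eq (h : IsNumberSystem d α D S Y₀ Y₁) (hα : 0 < α)
    (hadj : ∀ k u w, ⟪S k u, w⟫_ℂ = ⟪u, D k w⟫_ℂ) {w : (Fin d → ℕ) → H}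
    (hw0 : Y₀ (w 0) = ((α : ℂ)⁻¹) • w 0)
    (hw : ∀ n k, w (n + Pi.single k 1) = S k (w n))
    (hv0 : Y₀ (v 0) = ((α : ℂ)⁻¹) • v 0)
    (hv : ∀ n k, v (n + Pi.single k 1) = S k (v n)) (k n : Fin d → ℕ) :
    ⟪w k, v n⟫_ℂ =
      (if k = n then
        (((∏ i, Nat.factorial (n i) : ℕ) : ℝ) /
          (∏ j ∈ Finset.range (degIdx d n), ((j : ℝ) + 1 + α)) ^ 2 : ℝ)
       else (0 : ℝ)) * ⟪w 0, v 0⟫_ℂ := by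
  induction k using multiIndex_induction generalizing n with
  | zero =>
    cases n using multiIndex_induction with
    | zero => simp [degIdx]
    | add_single n l =>
      have : (0 : Fin d → ℕ) ≠ n + Pi.single l 1 := fun h0 => by
        simpa using congrFun h0 l
      rw [if_neg this, hv, ← inner_conj_symm, hadj, h.annihilate_vacuum hα hadj hw0]
      simp
  | add_single k l ih =>
    rw [hw, hadj, h.annihilate_apply hα hadj hv0 hv, inner_smul_right, ih]
    rcases eq_or_ne (n l) 0 with h0 | h0
    · have : k + Pi.single l 1 ≠ n := fun h1 => by
        have := congrFun h1 l
        simp at this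
        omega
      simp [h0, this]
    · obtain ⟨m, rfl⟩ := exists_eq_add_single h0
      simp only [add_tsub_cancel_right, add_left_inj]
      split_ifs with hkm
      · have hfac : ∏ i, Nat.factorial ((m + Pi.single l 1 : Fin d → ℕ) i) =
            (m l + 1) * ∏ i, Nat.factorial (m i) := by
          rw [← Finset.mul_prod_erase _ _ (Finset.mem_univ l),
            ← Finset.mul_prod_erase _ (fun i => Nat.factorial (m i)) (Finset.mem_univ l)]
          rw [Finset.prod_congr rfl (g := fun i => Nat.factorial (m i))]
          · simp [Nat.factorial_succ, mul_assoc]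
          · intro i hi
            simp [Finset.ne_of_mem_erase hi]
        have hp : (∏ j ∈ Finset.range (degIdx d m), ((j : ℂ) + 1 + α)) ≠ 0 :=
          Finset.prod_ne_zero_iff.2 fun j _ => by
            exact_mod_cast (by positivity : (j : ℝ) + 1 + α ≠ 0)
        have hc1 : (degIdx d m + 1 + α : ℂ) ≠ 0 := by
          exact_mod_cast (by positivity : (degIdx d m : ℝ) + 1 + α ≠ 0)
        rw [hfac, degIdx_add_single, Finset.prod_range_succ, ← mul_assoc]
        congr 1
        simp only [Pi.add_apply, Pi.single_eq_same]
        push_cast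
        rw [add_comm (α : ℂ)]
        field_simp
      · simp

end Vacuum

section Multipower

variable {M : Type*} [Monoid M]

theorem prod_ofFn_pow_add_single : ∀ {d : ℕ} {f : Fin d → M}
    (_ : ∀ i j, Commute (f i) (f j)) (n : Fin d → ℕ) (k : Fin d),
    (List.ofFn fun i => f i ^ (n + Pi.single k 1 : Fin d → ℕ) i).prod =
      (List.ofFn fun i => f i ^ n i).prod * f k
  | 0, _, _, _, k => k.elim0
  | d + 1, f, hf, n, k => by
    have htail (j : Fin (d + 1)) :
        Commute (f j) (List.ofFn fun i : Fin d => f i.succ ^ n i.succ).prod :=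
      Commute.list_prod_right _ _ fun x hx => by
        obtain ⟨i, rfl⟩ := List.mem_ofFn.1 hx
        exact (hf _ _).pow_right _
    rw [List.ofFn_succ, List.ofFn_succ, List.prod_cons, List.prod_cons]
    cases k using Fin.cases with
    | zero =>
      simp [pow_succ, mul_assoc, (htail 0).eq]
    | succ k =>
      have ih := prod_ofFn_pow_add_single (f := fun i : Fin d => f i.succ)
        (fun i j => hf _ _) (fun i => n i.succ) k
      have hs (i : Fin d) : (Pi.single k.succ 1 : Fin (d + 1) → ℕ) i.succ =
          (Pi.single k 1 : Fin d → ℕ) i := by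
        simp [Pi.single_apply]
      have h0 : (Pi.single k.succ 1 : Fin (d + 1) → ℕ) 0 = 0 :=
        Pi.single_eq_of_ne (Fin.succ_ne_zero k).symm _
      simp only [Pi.add_apply] at ih
      simp only [Pi.add_apply, hs, h0, add_zero, ih, mul_assoc]

end Multipower

section Fock

variable {d : ℕ} {α : ℝ} {xop : ℤ → ℤ → BdOp d} {yop : ℤ → BdOp d}

theorem BdOp.ext_e2 {T U : BdOp d} (h : ∀ n, T (e2 d n) = U (e2 d n)) : T = U :=
  lp.ext_continuousLinearMap (by simp) fun i => by
    ext1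
    simpa [e2] using h i

theorem aIdx_zero (n : Fin d → ℕ) : aIdx d 0 n = n := by simp [aIdx]

theorem aCoef_zero (n : Fin d → ℕ) : aCoef d 0 n = 1 := by simp [aCoef]

theorem aIdx_annihilate (i : Fin d) (n : Fin d → ℕ) :
    aIdx d ((i : ℕ) + 1) n = n - Pi.single i 1 := by
  have : 0 < ((i : ℕ) + 1 : ℤ) ∧ ((i : ℕ) + 1 : ℤ) ≤ d := by omega
  ext j
  rcases eq_or_ne j i with rfl | hj <;> simp [aIdx, *]

theorem aCoef_annihilate (i : Fin d) (n : Fin d → ℕ) :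
    aCoef d ((i : ℕ) + 1) n = Real.sqrt (n i) := by
  have : 0 < ((i : ℕ) + 1 : ℤ) ∧ ((i : ℕ) + 1 : ℤ) ≤ d := by omega
  simp [aCoef, this]

theorem aIdx_create (i : Fin d) (n : Fin d → ℕ) :
    aIdx d (-((i : ℕ) + 1)) n = n + Pi.single i 1 := by
  have h1 : ¬ (0 < (-((i : ℕ) + 1) : ℤ) ∧ (-((i : ℕ) + 1) : ℤ) ≤ d) := by omega
  have h2 : 0 < (-(-((i : ℕ) + 1)) : ℤ) ∧ (-(-((i : ℕ) + 1)) : ℤ) ≤ d := by omega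
  rw [aIdx, dif_neg h1, dif_pos h2]
  ext j
  rcases eq_or_ne j i with rfl | hj <;> simp [*]

theorem aCoef_create (i : Fin d) (n : Fin d → ℕ) :
    aCoef d (-((i : ℕ) + 1)) n = Real.sqrt (n i + 1) := by
  have h1 : ¬ (0 < (-((i : ℕ) + 1) : ℤ) ∧ (-((i : ℕ) + 1) : ℤ) ≤ d) := by omega
  have h2 : 0 < (-(-((i : ℕ) + 1)) : ℤ) ∧ (-(-((i : ℕ) + 1)) : ℤ) ≤ d := by omega
  rw [aCoef, dif_neg h1, dif_pos h2]
  simp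

theorem IsXYSystem.x_apply (h : IsXYSystem d α xop yop) (i : Fin d) (n : Fin d → ℕ) :
    xop ((i : ℕ) + 1) 0 (e2 d n) =
      ((Real.sqrt (n i) / (degIdx d n + α) : ℝ) : ℂ) • e2 d (n - Pi.single i 1) := by
  rw [h.1 _ _ (by rw [abs_le]; omega) (by simp)]
  simp [xCoef, xIdx, aIdx_zero, aCoef_zero, aIdx_annihilate, aCoef_annihilate]

theorem IsXYSystem.y_apply (h : IsXYSystem d α xop yop) (m : ℤ) (n : Fin d → ℕ) :
    yop m (e2 d n) = (((degIdx d n + α + m : ℝ)⁻¹ : ℝ) : ℂ) • e2 d n :=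
  h.2 m n

/-- The operator `(N + α)⁻¹ a_{-i}`, written in the generators of `X`. -/
def xStar (d : ℕ) (xop : ℤ → ℤ → BdOp d) (yop : ℤ → BdOp d) (i : Fin d) : BdOp d :=
  xop (-((i : ℕ) + 1)) 0 * (1 - yop 1)

theorem IsXYSystem.xStar_apply (h : IsXYSystem d α xop yop) (hα : 0 < α) (i : Fin d)
    (n : Fin d → ℕ) :
    xStar d xop yop i (e2 d n) =
      ((Real.sqrt (n i + 1) / (degIdx d n + 1 + α) : ℝ) : ℂ) • e2 d (n + Pi.single i 1) := by
  have h1 := h.1 (-((i : ℕ) + 1)) 0 (by rw [abs_le]; omega) (by simp) n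
  simp only [xCoef, xIdx, aIdx_zero, aCoef_zero, aIdx_create, aCoef_create, le_refl, or_true,
    if_true, mul_one] at h1
  have h2 : (degIdx d n + α : ℂ) ≠ 0 := by
    exact_mod_cast (by positivity : degIdx d n + α ≠ 0)
  have h3 : (degIdx d n + 1 + α : ℂ) ≠ 0 := by
    exact_mod_cast (by positivity : degIdx d n + 1 + α ≠ 0)
  rw [xStar, mul_apply_eq_comp, sub_apply, one_apply_eq_self, h.y_apply, map_sub, map_smul, h1,
    smul_smul, ← sub_smul]
  congr 1
  push_cast
  rw [add_right_comm (degIdx d n : ℂ)]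
  field_simp
  ring

theorem IsXYSystem.xStar_eq_star (h : IsXYSystem d α xop yop) (hα : 0 < α) (i : Fin d) :
    xStar d xop yop i = star (xop ((i : ℕ) + 1) 0) := by
  refine BdOp.ext_e2 fun m => ?_
  have key (n : Fin d → ℕ) : ⟪e2 d n, xStar d xop yop i (e2 d m)⟫_ℂ =
      ⟪e2 d n, star (xop ((i : ℕ) + 1) 0) (e2 d m)⟫_ℂ := by
    rw [ContinuousLinearMap.star_eq_adjoint, ContinuousLinearMap.adjoint_inner_right,
      h.x_apply, h.xStar_apply hα, inner_smul_left, inner_smul_right, Complex.conj_ofReal]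
    simp only [e2, lp.inner_single_left, lp.single_apply]
    by_cases hn : n = m + Pi.single i 1
    · subst hn
      simp [degIdx_add_single]
    · rw [Pi.single_eq_of_ne hn]
      rcases eq_or_ne (n i) 0 with h0 | h0
      · simp [h0]
      · have : n - Pi.single i 1 ≠ m := by
          rintro rfl
          exact hn (tsub_add_cancel_of_le (single_one_le h0)).symm
        rw [Pi.single_eq_of_ne this]
        simp
  ext n
  simpa [e2, lp.inner_single_left] using key n

theorem IsXYSystem.x_commute (h : IsXYSystem d α xop yop) (i j : Fin d) :
    Commute (xop ((i : ℕ) + 1) 0) (xop ((j : ℕ) + 1) 0) := by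
  rcases eq_or_ne i j with rfl | hij
  · exact Commute.refl _
  refine BdOp.ext_e2 fun m => ?_
  rcases eq_or_ne (m i) 0 with hi | hi
  · simp [h.x_apply, hi, hij]
  rcases eq_or_ne (m j) 0 with hj | hj
  · simp [h.x_apply, hj, hij.symm]
  obtain ⟨p, rfl⟩ := exists_eq_add_single hi
  obtain ⟨q, rfl⟩ := exists_eq_add_single (by simpa [hij.symm] using hj : p j ≠ 0)
  have hq : q + Pi.single j 1 + Pi.single i 1 - Pi.single j 1 = q + Pi.single i 1 := by
    rw [add_right_comm, add_tsub_cancel_right]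
  simp only [mul_apply_eq_comp, h.x_apply, map_smul, smul_smul, add_tsub_cancel_right, hq,
    ← Complex.ofReal_mul, degIdx_add_single]
  congr 2
  simp [hij, hij.symm]
  ring

theorem IsXYSystem.isNumberSystem (h : IsXYSystem d α xop yop) (hα : 0 < α) :
    IsNumberSystem d α (fun i => xop ((i : ℕ) + 1) 0) (xStar d xop yop) (yop 0) (yop 1) where
  sum_mul := by
    refine BdOp.ext_e2 fun m => ?_
    have hk (k : Fin d) : (xStar d xop yop k * xop ((k : ℕ) + 1) 0) (e2 d m) =
        ((m k / (degIdx d m + α) ^ 2 : ℝ) : ℂ) • e2 d m := by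
      rcases eq_or_ne (m k) 0 with h0 | h0
      · simp [h.x_apply, h0]
      obtain ⟨p, rfl⟩ := exists_eq_add_single h0
      simp only [mul_apply_eq_comp, h.x_apply, h.xStar_apply hα, map_smul, smul_smul,
        add_tsub_cancel_right, ← Complex.ofReal_mul, degIdx_add_single, Pi.add_apply,
        Pi.single_eq_same, Nat.cast_add, Nat.cast_one]
      congr 2
      rw [div_mul_div_comm, Real.mul_self_sqrt (by positivity), sq]
    have hm : (degIdx d m + α : ℝ) ≠ 0 := by positivity
    simp only [sum_apply, hk, ← Finset.sum_smul, ← Complex.ofReal_sum, ← Finset.sum_div,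
      ← Nat.cast_sum, sub_apply, smul_apply, mul_apply_eq_comp, h.y_apply, map_smul, smul_smul,
      ← Complex.ofReal_mul, ← sub_smul, ← Complex.ofReal_sub]
    congr 2
    change (degIdx d m : ℝ) / _ = _
    rw [Int.cast_zero, add_zero]
    field_simp
    ring
  shift k := by
    refine BdOp.ext_e2 fun m => ?_
    simp only [mul_apply_eq_comp, h.y_apply, h.xStar_apply hα, map_smul, smul_smul,
      degIdx_add_single, ← Complex.ofReal_mul]
    congr 2
    push_cast
    rw [add_zero, add_right_comm, mul_comm]
  resolvent := by
    refine BdOp.ext_e2 fun m => ?_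
    have h2 : (degIdx d m + α : ℂ) ≠ 0 := by
      exact_mod_cast (by positivity : degIdx d m + α ≠ 0)
    have h3 : (degIdx d m + α + 1 : ℂ) ≠ 0 := by
      exact_mod_cast (by positivity : degIdx d m + α + 1 ≠ 0)
    simp only [add_apply, mul_apply_eq_comp, h.y_apply, map_smul, smul_smul, ← add_smul]
    congr 1
    push_cast
    rw [add_zero]
    field_simp
  ccr l k := by
    refine BdOp.ext_e2 fun m => ?_
    rcases eq_or_ne k l with rfl | hkl
    · rcases eq_or_ne (m k) 0 with h0 | h0
      · simp only [if_true, add_apply, mul_apply_eq_comp, h.x_apply, h.y_apply, h.xStar_apply hα,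
          map_smul, smul_smul, add_tsub_cancel_right, ← Complex.ofReal_mul, degIdx_add_single,
          Pi.add_apply, Pi.single_eq_same, h0]
        simp [-Complex.coe_smul]
        congr 1
        rw [add_right_comm (degIdx d m : ℂ)]
      · obtain ⟨p, rfl⟩ := exists_eq_add_single h0
        simp only [if_true, add_apply, mul_apply_eq_comp, h.x_apply, h.y_apply, h.xStar_apply hα,
          map_smul, smul_smul, add_tsub_cancel_right, ← Complex.ofReal_mul, degIdx_add_single,
          Pi.add_apply, Pi.single_eq_same, ← add_smul, ← Complex.ofReal_add]
        congr 2
        have h1 := Real.mul_self_sqrt (by positivity : (0 : ℝ) ≤ p k + 1)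
        have h2 := Real.mul_self_sqrt (by positivity : (0 : ℝ) ≤ p k + 1 + 1)
        push_cast
        generalize Real.sqrt ((p k : ℝ) + 1) = s at h1 ⊢
        generalize Real.sqrt ((p k : ℝ) + 1 + 1) = t at h2 ⊢
        field_simp
        linear_combination ((degIdx d p : ℝ) + 1 + α) ^ 2 * (degIdx d p + 1 + α + 1) ^ 2 * (h2 - h1)
    · rcases eq_or_ne (m l) 0 with h0 | h0
      · simp [-Complex.coe_smul, h.x_apply, h.y_apply, h.xStar_apply hα, hkl, hkl.symm, h0]
      · obtain ⟨p, rfl⟩ := exists_eq_add_single h0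
        have hp : p + Pi.single l 1 + Pi.single k 1 - Pi.single l 1 = p + Pi.single k 1 := by
          rw [add_right_comm, add_tsub_cancel_right]
        simp only [hkl, if_false, zero_add, mul_apply_eq_comp, h.x_apply, h.y_apply,
          h.xStar_apply hα, map_smul, smul_smul, add_tsub_cancel_right, ← Complex.ofReal_mul,
          degIdx_add_single, hp, Pi.add_apply, Pi.single_eq_same, Pi.single_eq_of_ne hkl,
          Pi.single_eq_of_ne hkl.symm]
        congr 2
        push_cast
        simp only [add_zero]
        field_simp
        ring

end Fock

/-- Lemma 4.2: for `η, φ ∈ K₀ = ker(π(y₀) − α⁻¹ I)` and multi-indices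
`𝔨, 𝔫` with `|𝔨| + |𝔫| > 0`,
`⟨π((x^𝔨)*)η, π((x^𝔫)*)φ⟩ = δ_{𝔨,𝔫} n₁!⋯n_d! ((1+α)⋯(|𝔫|+α))⁻² ⟨η, φ⟩`. -/
theorem stmt16 (d : ℕ) (hd : 1 ≤ d) (α : ℝ) (hα : 0 < α)
    (hαint : ∀ z : ℤ, α ≠ (z : ℝ))
    (xop : ℤ → ℤ → BdOp d) (yop : ℤ → BdOp d) (hxy : IsXYSystem d α xop yop)
    {H : Type*} [NormedAddCommGroup H] [InnerProductSpace ℂ H] [CompleteSpace H]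
    (π : ↥(Xalg d xop yop) →ₐ[ℂ] (H →L[ℂ] H)) (hπ : IsStarRep d xop yop π)
    (Ty : ↥(Xalg d xop yop)) (hTy : (Ty : BdOp d) = yop 0)
    (xs : (Fin d → ℕ) → ↥(Xalg d xop yop))
    (hxs : ∀ n : Fin d → ℕ, (xs n : BdOp d) = star (xPowZ d xop n))
    (η φ : H)
    (hη : π Ty η = ((α⁻¹ : ℝ) : ℂ) • η) (hφ : π Ty φ = ((α⁻¹ : ℝ) : ℂ) • φ)
    (k n : Fin d → ℕ) (hkn : 0 < degIdx d k + degIdx d n) :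
    ⟪π (xs k) η, π (xs n) φ⟫_ℂ =
      (if k = n then
        (((∏ i, Nat.factorial (n i) : ℕ) : ℝ) /
          (∏ j ∈ Finset.range (degIdx d n), ((j : ℝ) + 1 + α)) ^ 2 : ℝ)
       else (0 : ℝ)) * ⟪η, φ⟫_ℂ := by
  have hX (i : Fin d) : xop ((i : ℕ) + 1) 0 ∈ Xalg d xop yop :=
    Algebra.subset_adjoin (Or.inl ⟨_, _, by rw [abs_le]; omega, by simp, rfl⟩)
  have hY : yop 1 ∈ Xalg d xop yop := Algebra.subset_adjoin (Or.inr ⟨1, rfl⟩)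
  have hS (i : Fin d) : xStar d xop yop i ∈ Xalg d xop yop :=
    mul_mem (Algebra.subset_adjoin (Or.inl ⟨_, _, by rw [abs_le]; omega, by simp, rfl⟩))
      (sub_mem (one_mem _) hY)
  let D : Fin d → Xalg d xop yop := fun i => ⟨_, hX i⟩
  let S : Fin d → Xalg d xop yop := fun i => ⟨_, hS i⟩
  have hsys : IsNumberSystem d α D S Ty ⟨_, hY⟩ :=
    .of_map (Xalg d xop yop).val Subtype.val_injective
      (by simpa [hTy, D, S] using hxy.isNumberSystem hα)
  have hadj (i : Fin d) (u w : H) : ⟪π (S i) u, w⟫_ℂ = ⟪u, π (D i) w⟫_ℂ := by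
    rw [hπ (S i) (D i) (hxy.xStar_eq_star hα i), ContinuousLinearMap.star_eq_adjoint,
      ContinuousLinearMap.adjoint_inner_left]
  have hxs0 : xs 0 = 1 := Subtype.ext (by simp [hxs, xPowZ])
  have hxs1 (m : Fin d → ℕ) (i : Fin d) : xs (m + Pi.single i 1) = S i * xs m :=
    Subtype.ext (by
      simp only [hxs, xPowZ, MulMemClass.coe_mul, S, hxy.xStar_eq_star hα]
      rw [prod_ofFn_pow_add_single hxy.x_commute, star_mul])
  have key := (hsys.map π).inner_eq hα hadj (w := fun m => π (xs m) η) (v := fun m => π (xs m) φ)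
    (by simpa [hxs0] using hη) (fun m i => by simp [hxs1])
    (by simpa [hxs0] using hφ) (fun m i => by simp [hxs1]) k n
  simpa only [hxs0, map_one, one_apply_eq_self] using key
end
end

section
/- Let d ≥ 1 and let complex numbers w_{kl} be given for k, l ∈ {−d,…,−1,1,…,d}, satisfying: w_{kl} = w_{lk} for all k, l; conj(w_{kl}) = w_{−l,−k} for all k, l; w_{ij} w_{kl} = w_{kj} w_{il} for all i, j, k, l; and Σ_{k=1}^d w_{k,−k} = 1. Then there exists z = (z₁,…,z_d) ∈ ℂ^d with |z₁|² + ⋯ + |z_d|² = 1 such that for all k, l = 1,…,d: w_{kl} = z_k z_l, w_{k,−l} = z_k conj(z_l), and w_{−k,−l} = conj(z_k) conj(z_l). -/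
noncomputable section

/-- A sum over the integer interval `[1, d]`, reindexed by `Fin d`. -/
theorem sum_Icc_one_eq_sum_fin {M : Type*} [AddCommMonoid M] (d : ℕ) (f : ℤ → M) :
    ∑ k ∈ Finset.Icc (1 : ℤ) (d : ℤ), f k = ∑ i : Fin d, f ((i : ℕ) + 1 : ℤ) := by
  symm
  refine Finset.sum_bij (fun i _ => ((i : ℕ) + 1 : ℤ)) ?_ ?_ ?_ (fun _ _ => rfl)
  · intro i _
    have := i.isLt
    simp only [Finset.mem_Icc]
    omega
  · intro i _ j _ h
    apply Fin.ext
    omega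
  · intro k hk
    rw [Finset.mem_Icc] at hk
    refine ⟨⟨(k - 1).toNat, by omega⟩, Finset.mem_univ _, ?_⟩
    dsimp only
    omega

/-- If `p > 0` and `p ^ 2 = a * conj a`, then `a` has a nonzero square root `ζ`, and
`ζ * conj ζ = p`. -/
theorem exists_sq_eq_and_mul_conj_eq {a : ℂ} {p : ℝ} (hp : 0 < p)
    (h : (p : ℂ) * p = a * (starRingEnd ℂ) a) :
    ∃ ζ : ℂ, ζ ≠ 0 ∧ ζ * ζ = a ∧ ζ * (starRingEnd ℂ) ζ = p := by
  obtain ⟨ζ, hζ⟩ := IsAlgClosed.exists_pow_nat_eq a (n := 2) two_pos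
  have hn : Complex.normSq ζ = p := by
    rw [← hζ, map_pow, show ζ ^ 2 * (starRingEnd ℂ) ζ ^ 2 = (ζ * (starRingEnd ℂ) ζ) ^ 2 by ring,
      Complex.mul_conj] at h
    have h' : p * p = Complex.normSq ζ ^ 2 := by exact_mod_cast h
    nlinarith [Complex.normSq_nonneg ζ]
  refine ⟨ζ, ?_, by rw [← hζ, sq], by rw [Complex.mul_conj, hn]⟩
  rintro rfl
  simp at hn
  exact hp.ne hn

/-- Section 4.3: classification of the characters of the commutative
C*-algebra generated by the `π_∞(x_{kl})`. If complex numbers `w_{kl}`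
(`k, l ∈ {−d,…,−1,1,…,d}`) satisfy `w_{kl} = w_{lk}`,
`conj(w_{kl}) = w_{−l,−k}`, `w_{ij} w_{kl} = w_{kj} w_{il}` and
`Σ_{k=1}^d w_{k,−k} = 1`, then there is a point `z` of the unit sphere of
`ℂ^d` with `w_{kl} = z_k z_l`, `w_{k,−l} = z_k conj(z_l)` and
`w_{−k,−l} = conj(z_k) conj(z_l)` for `k, l = 1, …, d`. -/
theorem stmt18 (d : ℕ) (hd : 1 ≤ d) (w : ℤ → ℤ → ℂ)
    (hsym : ∀ k l : ℤ, k ≠ 0 → l ≠ 0 → |k| ≤ (d : ℤ) → |l| ≤ (d : ℤ) →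
      w k l = w l k)
    (hconj : ∀ k l : ℤ, k ≠ 0 → l ≠ 0 → |k| ≤ (d : ℤ) → |l| ≤ (d : ℤ) →
      (starRingEnd ℂ) (w k l) = w (-l) (-k))
    (hmul : ∀ i j k l : ℤ, i ≠ 0 → j ≠ 0 → k ≠ 0 → l ≠ 0 →
      |i| ≤ (d : ℤ) → |j| ≤ (d : ℤ) → |k| ≤ (d : ℤ) → |l| ≤ (d : ℤ) →
      w i j * w k l = w k j * w i l)
    (hsum : ∑ k ∈ Finset.Icc (1 : ℤ) (d : ℤ), w k (-k) = 1) :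
    ∃ z : Fin d → ℂ,
      (∑ i, Complex.normSq (z i)) = 1 ∧
      ∀ k l : Fin d,
        w ((k : ℕ) + 1 : ℤ) ((l : ℕ) + 1 : ℤ) = z k * z l ∧
        w ((k : ℕ) + 1 : ℤ) (-((l : ℕ) + 1) : ℤ) = z k * (starRingEnd ℂ) (z l) ∧
        w (-((k : ℕ) + 1) : ℤ) (-((l : ℕ) + 1) : ℤ) =
          (starRingEnd ℂ) (z k) * (starRingEnd ℂ) (z l) := by
  have hpos : ∃ m ∈ Finset.Icc (1 : ℤ) (d : ℤ), 0 < (w m (-m)).re := by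
    apply Finset.exists_lt_of_sum_lt
    rw [← Complex.re_sum, hsum]
    simp
  obtain ⟨m, hm, hmpos⟩ := hpos
  rw [Finset.mem_Icc] at hm
  have m0 : m ≠ 0 := by omega
  have n0 : -m ≠ 0 := by omega
  have mb : |m| ≤ (d : ℤ) := by rw [abs_le]; omega
  have nb : |-m| ≤ (d : ℤ) := by rwa [abs_neg]
  have hreal : (((w m (-m)).re : ℝ) : ℂ) = w m (-m) := by
    rw [← Complex.conj_eq_iff_re]
    simpa using hconj m (-m) m0 n0 mb nb
  obtain ⟨ζ, hζ0, hζ, hζp⟩ := exists_sq_eq_and_mul_conj_eq (a := w m m) hmpos (by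
    rw [hreal, hconj m m m0 m0 mb mb]
    conv_lhs => rw [hsym m (-m) m0 n0 mb nb]
    have h1 := hmul (-m) m m (-m) n0 m0 m0 n0 nb mb mb nb
    rw [← h1, hsym m (-m) m0 n0 mb nb])
  rw [hreal] at hζp
  have hζc : (starRingEnd ℂ) ζ ≠ 0 := by simpa using hζ0
  have hfac : ∀ k l : ℤ, k ≠ 0 → l ≠ 0 → |k| ≤ (d : ℤ) → |l| ≤ (d : ℤ) →
      w k l = w k m / ζ * (w l m / ζ) := by
    intro k l k0 l0 kb lb
    have h := hmul k m m l k0 m0 m0 l0 kb mb mb lb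
    rw [hsym m l m0 l0 mb lb, ← hζ] at h
    field_simp
    linear_combination -h
  have hv : ∀ k : ℤ, k ≠ 0 → |k| ≤ (d : ℤ) →
      w (-k) m / ζ = (starRingEnd ℂ) (w k m / ζ) := by
    intro k k0 kb
    have k0' : -k ≠ 0 := by omega
    have kb' : |-k| ≤ (d : ℤ) := by rwa [abs_neg]
    have h := hmul (-k) (-m) m m k0' n0 m0 m0 kb' nb mb mb
    rw [← hζ, ← hζp] at h
    rw [map_div₀, hconj k m k0 m0 kb mb, hsym (-m) (-k) n0 k0' nb kb', div_eq_div_iff hζ0 hζc]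
    apply mul_left_cancel₀ hζ0
    linear_combination -h
  have hne : ∀ k : Fin d, ((k : ℕ) + 1 : ℤ) ≠ 0 := fun k => by omega
  have hb : ∀ k : Fin d, |((k : ℕ) + 1 : ℤ)| ≤ (d : ℤ) := fun k => by
    rw [abs_le]; omega
  have hne' : ∀ k : Fin d, (-((k : ℕ) + 1) : ℤ) ≠ 0 := fun k => by omega
  have hb' : ∀ k : Fin d, |(-((k : ℕ) + 1) : ℤ)| ≤ (d : ℤ) := fun k => by
    rw [abs_neg]; exact hb k
  refine ⟨fun k => w ((k : ℕ) + 1 : ℤ) m / ζ, ?_, fun k l => ⟨?_, ?_, ?_⟩⟩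
  · rw [sum_Icc_one_eq_sum_fin] at hsum
    rw [← Complex.ofReal_inj, Complex.ofReal_sum, Complex.ofReal_one, ← hsum]
    refine Finset.sum_congr rfl fun k _ => ?_
    rw [← Complex.mul_conj, hfac _ _ (hne k) (hne' k) (hb k) (hb' k), hv _ (hne k) (hb k)]
  · exact hfac _ _ (hne k) (hne l) (hb k) (hb l)
  · rw [hfac _ _ (hne k) (hne' l) (hb k) (hb' l), hv _ (hne l) (hb l)]
  · rw [hfac _ _ (hne' k) (hne' l) (hb' k) (hb' l), hv _ (hne k) (hb k), hv _ (hne l) (hb l)]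
end
end

section
/- Let d = 1 and set c_ε = (N − 1)(N − 2) + ε·1 ∈ W(1). For every real number α with α² < 2 and every ε > 0, the element (N + α·1) c_ε (N + α·1) belongs to Σ²(W(1)). -/
noncomputable section

open scoped ComplexOrder

/-- The space `F` of finitely supported functions `ℕ^d → ℂ`. -/
abbrev FS (d : ℕ) := (Fin d → ℕ) →₀ ℂ

/-- The inner product `⟨φ, ψ⟩ = Σ_𝔫 conj(φ 𝔫) · ψ 𝔫` on `F`. -/
def ipF (d : ℕ) (φ ψ : FS d) : ℂ :=
  φ.sum fun n c => (starRingEnd ℂ) c * ψ n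

/-- The annihilation operators `a_k e_𝔫 = √(n_k) e_{𝔫−1_k}`. -/
def aop (d : ℕ) (k : Fin d) : Module.End ℂ (FS d) :=
  Finsupp.linearCombination ℂ fun n : Fin d → ℕ =>
    (Real.sqrt (n k) : ℂ) • Finsupp.single (Function.update n k (n k - 1)) (1 : ℂ)

/-- The creation operators `a_{−k} e_𝔫 = √(n_k + 1) e_{𝔫+1_k}`. -/
def acr (d : ℕ) (k : Fin d) : Module.End ℂ (FS d) :=
  Finsupp.linearCombination ℂ fun n : Fin d → ℕ =>
    (Real.sqrt (n k + 1) : ℂ) • Finsupp.single (Function.update n k (n k + 1)) (1 : ℂ)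

/-- The Weyl algebra `W(d)`: the unital subalgebra of `End(F)` generated by
`a_1, …, a_d, a_{−1}, …, a_{−d}`. -/
def Weyl (d : ℕ) : Subalgebra ℂ (Module.End ℂ (FS d)) :=
  Algebra.adjoin ℂ (Set.range (aop d) ∪ Set.range (acr d))

/-- The number operator `N = Σ_k a_{−k} a_k`. -/
def Nop (d : ℕ) : Module.End ℂ (FS d) := ∑ k : Fin d, acr d k * aop d k

/-- `y` is the formal adjoint of `x`: `⟨xφ, ψ⟩ = ⟨φ, yψ⟩` for all `φ, ψ ∈ F`. -/
def IsAdj (d : ℕ) (x y : Module.End ℂ (FS d)) : Prop :=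
  ∀ φ ψ : FS d, ipF d (x φ) ψ = ipF d φ (y ψ)

/-- The positive cone `W(d)_+ = {x ∈ W(d) : ⟨xφ, φ⟩ ≥ 0 for all φ ∈ F}`. -/
def WeylPos (d : ℕ) : Set (Module.End ℂ (FS d)) :=
  {x | x ∈ Weyl d ∧ ∀ φ : FS d, 0 ≤ ipF d (x φ) φ}

/-- `Σ²(W(d))`: finite sums `Σ_i x_i* x_i` with `x_i ∈ W(d)`. -/
def WeylSumSq (d : ℕ) : Set (Module.End ℂ (FS d)) :=
  {y | ∃ (m : ℕ) (g gs : Fin m → Module.End ℂ (FS d)),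
    (∀ i, g i ∈ Weyl d) ∧ (∀ i, gs i ∈ Weyl d) ∧
    (∀ i, IsAdj d (g i) (gs i)) ∧ y = ∑ i, gs i * g i}

/-- The monomial `a₁^{k₁} ⋯ a_d^{k_d} a_{−1}^{l₁} ⋯ a_{−d}^{l_d}`. -/
def monoW (d : ℕ) (p : (Fin d → ℕ) × (Fin d → ℕ)) : Module.End ℂ (FS d) :=
  (List.ofFn fun k : Fin d => aop d k ^ p.1 k).prod *
    (List.ofFn fun k : Fin d => acr d k ^ p.2 k).prod

/-- The degree-`m` symbol of the coefficient family `γ`: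
`Σ_{|𝔨|+|𝔩| = m} γ_{𝔨,𝔩} z^𝔨 conj(z)^𝔩`. -/
def symb (d : ℕ) (γ : ((Fin d → ℕ) × (Fin d → ℕ)) →₀ ℂ) (m : ℕ)
    (z : Fin d → ℂ) : ℂ :=
  ∑ p ∈ γ.support.filter (fun p => degIdx d p.1 + degIdx d p.2 = m),
    γ p * (∏ k, z k ^ p.1 k) * ∏ k, (starRingEnd ℂ) (z k) ^ p.2 k

/-- The set `𝒩` of finite products of elements `N + (α + n)·1`, `n ∈ ℤ`. -/
def NSet (d : ℕ) (α : ℝ) : Set (Module.End ℂ (FS d)) :=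
  {b | ∃ l : List ℤ, b =
    (l.map fun z : ℤ => Nop d + ((α + z : ℝ) : ℂ) • (1 : Module.End ℂ (FS d))).prod}

theorem ipF_add_left {d : ℕ} (φ φ' ψ : FS d) : ipF d (φ + φ') ψ = ipF d φ ψ + ipF d φ' ψ :=
  Finsupp.sum_add_index' (by simp) (by intros; simp [add_mul])

theorem ipF_add_right {d : ℕ} (φ ψ ψ' : FS d) : ipF d φ (ψ + ψ') = ipF d φ ψ + ipF d φ ψ' := by
  simp [ipF, mul_add, Finsupp.sum_add]

theorem ipF_smul_left {d : ℕ} (c : ℂ) (φ ψ : FS d) :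
    ipF d (c • φ) ψ = (starRingEnd ℂ) c * ipF d φ ψ := by
  rw [ipF, ipF, Finsupp.sum_smul_index' (by simp), Finsupp.mul_sum]
  simp [mul_assoc]

theorem ipF_smul_right {d : ℕ} (c : ℂ) (φ ψ : FS d) :
    ipF d φ (c • ψ) = c * ipF d φ ψ := by
  simp [ipF, Finsupp.mul_sum, mul_left_comm]

theorem ipF_single_left {d : ℕ} (n : Fin d → ℕ) (c : ℂ) (ψ : FS d) :
    ipF d (Finsupp.single n c) ψ = (starRingEnd ℂ) c * ψ n := by
  simp [ipF]

theorem ipF_conj_symm {d : ℕ} (φ ψ : FS d) : (starRingEnd ℂ) (ipF d φ ψ) = ipF d ψ φ := by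
  induction φ using Finsupp.induction_linear with
  | zero => simp [ipF]
  | add f g hf hg => rw [ipF_add_left, ipF_add_right, map_add, hf, hg]
  | single n c =>
    induction ψ using Finsupp.induction_linear with
    | zero => simp [ipF]
    | add f g hf hg => rw [ipF_add_left, ipF_add_right, map_add, hf, hg]
    | single m b =>
      simp only [ipF_single_left, Finsupp.single_apply]
      by_cases h : n = m
      · simp [h, mul_comm]
      · simp [h, Ne.symm h]

theorem IsAdj.symm {d : ℕ} {x y : Module.End ℂ (FS d)} (h : IsAdj d x y) : IsAdj d y x := by
  intro φ ψ
  rw [← ipF_conj_symm, ← h, ipF_conj_symm]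

theorem IsAdj.one {d : ℕ} : IsAdj d 1 1 := fun _ _ => rfl

theorem IsAdj.mul {d : ℕ} {x y x' y' : Module.End ℂ (FS d)} (h : IsAdj d x y)
    (h' : IsAdj d x' y') : IsAdj d (x * x') (y' * y) := fun φ ψ => by
  simp only [Module.End.mul_apply]
  rw [h, h']

theorem IsAdj.add {d : ℕ} {x y x' y' : Module.End ℂ (FS d)} (h : IsAdj d x y)
    (h' : IsAdj d x' y') : IsAdj d (x + x') (y + y') := fun φ ψ => by
  simp only [LinearMap.add_apply]
  rw [ipF_add_left, ipF_add_right, h, h']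

theorem IsAdj.real_smul {d : ℕ} {x y : Module.End ℂ (FS d)} (r : ℝ) (h : IsAdj d x y) :
    IsAdj d ((r : ℂ) • x) ((r : ℂ) • y) := fun φ ψ => by
  simp only [LinearMap.smul_apply]
  rw [ipF_smul_left, ipF_smul_right, h, Complex.conj_ofReal]

theorem aop_single {d : ℕ} (k : Fin d) (n : Fin d → ℕ) (c : ℂ) :
    aop d k (Finsupp.single n c) =
      Finsupp.single (Function.update n k (n k - 1)) (c * (Real.sqrt (n k) : ℂ)) := by
  simp [aop, Finsupp.linearCombination_single]

theorem acr_single {d : ℕ} (k : Fin d) (n : Fin d → ℕ) (c : ℂ) :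
    acr d k (Finsupp.single n c) =
      Finsupp.single (Function.update n k (n k + 1)) (c * (Real.sqrt (n k + 1) : ℂ)) := by
  simp [acr, Finsupp.linearCombination_single]

theorem isAdj_aop_acr {d : ℕ} (k : Fin d) : IsAdj d (aop d k) (acr d k) := by
  intro φ ψ
  induction φ using Finsupp.induction_linear with
  | zero => simp [ipF]
  | add f g hf hg => rw [map_add, ipF_add_left, ipF_add_left, hf, hg]
  | single n c =>
    induction ψ using Finsupp.induction_linear with
    | zero => simp [ipF]
    | add f g hf hg => rw [map_add, ipF_add_right, ipF_add_right, hf, hg]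
    | single m b =>
      rw [aop_single, acr_single, ipF_single_left, ipF_single_left, Finsupp.single_apply,
        Finsupp.single_apply]
      by_cases h : Function.update m k (m k + 1) = n
      · subst h
        simp [mul_assoc, mul_comm]
      · rw [if_neg h]
        split_ifs with h'
        · subst h'
          have hn : n k = 0 := by
            by_contra hn
            refine h ?_
            simp [Nat.sub_add_cancel (Nat.one_le_iff_ne_zero.mpr hn)]
          simp [hn]
        · simp

theorem acr_mul_aop_single {d : ℕ} (k : Fin d) (n : Fin d → ℕ) (c : ℂ) :
    (acr d k * aop d k) (Finsupp.single n c) = Finsupp.single n (c * n k) := by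
  rw [Module.End.mul_apply, aop_single, acr_single]
  rcases Nat.eq_zero_or_pos (n k) with h | h
  · simp [h]
  · simp only [Function.update_self, Function.update_idem, Nat.sub_add_cancel h,
      Function.update_eq_self, Nat.cast_pred h, sub_add_cancel, mul_assoc]
    rw [← Complex.ofReal_mul, Real.mul_self_sqrt (by positivity), Complex.ofReal_natCast]

theorem aop_mul_acr {d : ℕ} (k : Fin d) : aop d k * acr d k = acr d k * aop d k + 1 := by
  ext n : 2
  have h : (0 : ℝ) ≤ n k + 1 := by positivity
  simp only [LinearMap.comp_apply, Finsupp.lsingle_apply, LinearMap.add_apply,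
    acr_mul_aop_single, Module.End.one_apply]
  rw [Module.End.mul_apply, acr_single, aop_single, ← Finsupp.single_add]
  simp only [Function.update_self, Function.update_idem, Nat.add_sub_cancel,
      Function.update_eq_self, mul_assoc, Nat.cast_add, Nat.cast_one]
  rw [← Complex.ofReal_mul, Real.mul_self_sqrt h]
  push_cast
  ring_nf

section Ladder

variable {R : Type*} [Ring R] {A B : R}

theorem sq_mul_sq_of_ladder (h : A * B = B * A + 1) :
    B ^ 2 * A ^ 2 = B * A * (B * A - 1) := by
  have : B * A = A * B - 1 := by rw [h]; abel
  calc B ^ 2 * A ^ 2 = B * (B * A) * A := by noncomm_ring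
    _ = B * (A * B - 1) * A := by rw [← this]
    _ = _ := by noncomm_ring

theorem cube_mul_cube_of_ladder (h : A * B = B * A + 1) :
    B ^ 3 * A ^ 3 = B * A * (B * A - 1) * (B * A - 2) := by
  have hA : A * (B * A) = (B * A + 1) * A := by rw [← h, mul_assoc]
  have hA' : (B * A - 1) * A = A * (B * A - 2) := by
    rw [mul_sub, hA]; noncomm_ring
  calc B ^ 3 * A ^ 3 = B * (B ^ 2 * A ^ 2) * A := by noncomm_ring
    _ = B * (B * A) * ((B * A - 1) * A) := by rw [sq_mul_sq_of_ladder h]; noncomm_ring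
    _ = (B * (B * A) * A) * (B * A - 2) := by rw [hA']; noncomm_ring
    _ = (B ^ 2 * A ^ 2) * (B * A - 2) := by noncomm_ring
    _ = _ := by rw [sq_mul_sq_of_ladder h]

end Ladder

theorem add_mem_WeylSumSq {d : ℕ} {x y : Module.End ℂ (FS d)} (hx : x ∈ WeylSumSq d)
    (hy : y ∈ WeylSumSq d) : x + y ∈ WeylSumSq d := by
  obtain ⟨m, g, gs, hg, hgs, had, rfl⟩ := hx
  obtain ⟨m', g', gs', hg', hgs', had', rfl⟩ := hy
  refine ⟨m + m', Fin.append g g', Fin.append gs gs', ?_, ?_, ?_, ?_⟩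
  · exact Fin.addCases (by simpa using hg) (by simpa using hg')
  · exact Fin.addCases (by simpa using hgs) (by simpa using hgs')
  · exact Fin.addCases (by simpa using had) (by simpa using had')
  · simp [Fin.sum_univ_add]

theorem smul_mul_mem_WeylSumSq {d : ℕ} {r : ℝ} (hr : 0 ≤ r) {x y : Module.End ℂ (FS d)}
    (hx : x ∈ Weyl d) (hy : y ∈ Weyl d) (h : IsAdj d x y) :
    (r : ℂ) • (y * x) ∈ WeylSumSq d := by
  refine ⟨1, fun _ => (Real.sqrt r : ℂ) • x, fun _ => (Real.sqrt r : ℂ) • y,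
    fun _ => Subalgebra.smul_mem _ hx _, fun _ => Subalgebra.smul_mem _ hy _,
    fun _ => h.real_smul _, ?_⟩
  simp only [Finset.univ_unique, Finset.sum_const, Finset.card_singleton, one_smul,
    smul_mul_smul_comm]
  rw [← Complex.ofReal_mul, Real.mul_self_sqrt hr]

theorem aop_mem_Weyl {d : ℕ} (k : Fin d) : aop d k ∈ Weyl d :=
  Algebra.subset_adjoin (Or.inl ⟨k, rfl⟩)

theorem acr_mem_Weyl {d : ℕ} (k : Fin d) : acr d k ∈ Weyl d :=
  Algebra.subset_adjoin (Or.inr ⟨k, rfl⟩)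

theorem IsAdj.pow {d : ℕ} {x y : Module.End ℂ (FS d)} (h : IsAdj d x y) (j : ℕ) :
    IsAdj d (x ^ j) (y ^ j) := by
  induction j with
  | zero => simpa using IsAdj.one
  | succ j ih => rw [pow_succ, pow_succ']; exact ih.mul h

theorem number_add_mem_Weyl (r : ℝ) :
    Nop 1 + (r : ℂ) • (1 : Module.End ℂ (FS 1)) ∈ Weyl 1 := by
  rw [Nop, Fin.sum_univ_one]
  exact add_mem (mul_mem (acr_mem_Weyl 0) (aop_mem_Weyl 0))
    (Subalgebra.smul_mem _ (one_mem _) _)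

theorem isAdj_number_add (r : ℝ) :
    IsAdj 1 (Nop 1 + (r : ℂ) • (1 : Module.End ℂ (FS 1)))
      (Nop 1 + (r : ℂ) • (1 : Module.End ℂ (FS 1))) := by
  rw [Nop, Fin.sum_univ_one]
  exact ((isAdj_aop_acr 0).symm.mul (isAdj_aop_acr 0)).add (IsAdj.one.real_smul r)

theorem add_ofReal_neg_smul_one {R : Type*} [Ring R] [Algebra ℂ R] (n : R) :
    n + ((-1 : ℝ) : ℂ) • (1 : R) = n - 1 ∧ n + ((-2 : ℝ) : ℂ) • (1 : R) = n - 2 := by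
  have h2 : (2 : R) = (2 : ℂ) • 1 := by rw [two_smul, one_add_one_eq_two]
  rw [h2]
  push_cast
  exact ⟨by module, by module⟩

/-- The polynomial identity behind the sum of squares, as an identity in any `ℂ`-algebra. -/
theorem quartic_decomposition {R : Type*} [Ring R] [Algebra ℂ R] (n : R) (α ε : ℂ) :
    (n + α • 1) * ((n - 1) * (n - 2) + ε • 1) * (n + α • 1) =
      ε • ((n + α • 1) * (n + α • 1)) +
      (α ^ 2 / 2) • (((n - 2) * (n - 1)) * ((n - 1) * (n - 2))) +
      (1 - α ^ 2 / 2) • ((n - 2) * (n * (n - 1)) * (n - 2)) +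
      ((α + 2) ^ 2 / 2) • (n * (n - 1) * (n - 2)) := by
  have h2 : (2 : R) = (2 : ℂ) • 1 := by rw [two_smul, one_add_one_eq_two]
  rw [h2]
  simp only [mul_add, add_mul, mul_sub, sub_mul, smul_mul_assoc, mul_smul_comm, one_mul, mul_one,
    smul_add, smul_sub, mul_assoc]
  module

/-- The example of Section 6: for `d = 1`, `c_ε = (N−1)(N−2) + ε·1` and any
real `α` with `α² < 2`, `ε > 0`, one has `(N+α) c_ε (N+α) ∈ Σ²(W(1))`. -/
theorem stmt19 (α : ℝ) (hα : α ^ 2 < 2) (ε : ℝ) (hε : 0 < ε) :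
    (Nop 1 + (α : ℂ) • (1 : Module.End ℂ (FS 1))) *
        ((Nop 1 - 1) * (Nop 1 - 2) + (ε : ℂ) • (1 : Module.End ℂ (FS 1))) *
        (Nop 1 + (α : ℂ) • (1 : Module.End ℂ (FS 1))) ∈ WeylSumSq 1 := by
  have hN : Nop 1 = acr 1 0 * aop 1 0 := by rw [Nop, Fin.sum_univ_one]
  have hlad := aop_mul_acr (0 : Fin 1)
  obtain ⟨e1, e2⟩ : Nop 1 + ((-1 : ℝ) : ℂ) • (1 : Module.End ℂ (FS 1)) = Nop 1 - 1 ∧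
      Nop 1 + ((-2 : ℝ) : ℂ) • (1 : Module.End ℂ (FS 1)) = Nop 1 - 2 :=
    add_ofReal_neg_smul_one (R := Module.End ℂ (FS 1)) (Nop 1)
  have hsq : acr 1 0 ^ 2 * aop 1 0 ^ 2 = Nop 1 * (Nop 1 - 1) := by
    rw [hN]
    exact sq_mul_sq_of_ladder (R := Module.End ℂ (FS 1)) hlad
  have hcube : acr 1 0 ^ 3 * aop 1 0 ^ 3 = Nop 1 * (Nop 1 - 1) * (Nop 1 - 2) := by
    rw [hN]
    exact cube_mul_cube_of_ladder (R := Module.End ℂ (FS 1)) hlad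
  have a1 : IsAdj 1 (Nop 1 - 1) (Nop 1 - 1) := e1 ▸ isAdj_number_add (-1)
  have a2 : IsAdj 1 (Nop 1 - 2) (Nop 1 - 2) := e2 ▸ isAdj_number_add (-2)
  have m1 : Nop 1 - 1 ∈ Weyl 1 := e1 ▸ number_add_mem_Weyl (-1)
  have m2 : Nop 1 - 2 ∈ Weyl 1 := e2 ▸ number_add_mem_Weyl (-2)
  have ma := aop_mem_Weyl (0 : Fin 1)
  have mc := acr_mem_Weyl (0 : Fin 1)
  have hac := isAdj_aop_acr (0 : Fin 1)
  have t1 := smul_mul_mem_WeylSumSq hε.le (number_add_mem_Weyl α) (number_add_mem_Weyl α)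
    (isAdj_number_add α)
  have t2 := smul_mul_mem_WeylSumSq (r := α ^ 2 / 2) (by positivity) (mul_mem m1 m2)
    (mul_mem m2 m1) (a1.mul a2)
  have t3 := smul_mul_mem_WeylSumSq (r := 1 - α ^ 2 / 2) (by linarith)
    (mul_mem (pow_mem ma 2) m2) (mul_mem m2 (pow_mem mc 2)) ((hac.pow 2).mul a2)
  have t4 := smul_mul_mem_WeylSumSq (r := (α + 2) ^ 2 / 2) (by positivity)
    (pow_mem ma 3) (pow_mem mc 3) (hac.pow 3)
  have h3 : (Nop 1 - 2) * acr 1 0 ^ 2 * (aop 1 0 ^ 2 * (Nop 1 - 2)) =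
      (Nop 1 - 2) * (Nop 1 * (Nop 1 - 1)) * (Nop 1 - 2) := by
    rw [← hsq]
    simp only [mul_assoc]
  rw [h3] at t3
  rw [hcube] at t4
  push_cast at t1 t2 t3 t4
  exact Set.mem_of_eq_of_mem (quartic_decomposition (R := Module.End ℂ (FS 1)) (Nop 1) (α : ℂ) ε) <|
    add_mem_WeylSumSq (add_mem_WeylSumSq (add_mem_WeylSumSq t1 t2) t3) t4
end
end
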